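/- arXiv:1402.0668 — 3 statements merged into one kernel-verified Lean document; each statement's English description precedes it below -/
import Mathlib

section
/- Given positive integers k and t with k ≥ t+1, there exists an integer n₀ = n₀(k,t) such that for all n ≥ n₀, every t-intersecting family A ⊆ S_{n,k} satisfies |A| ≤ [n-t, k-t], where [m, j] denotes the unsigned Stirling number of the first kind, i.e., the number of permutations of an m-element set with exactly j cycles. -/
/-- The set of cycles of a permutation `π` of `Fin n`: a cycle is encoded as a pair
`(S, f)` consisting of a `π`-orbit `S` together with the function agreeing with `π`
on `S` and with the identity off `S`.  Fixed points count as 1-cycles. -/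
def Equiv.Perm.cycleSet {n : ℕ} (π : Equiv.Perm (Fin n)) :
    Set (Finset (Fin n) × (Fin n → Fin n)) :=
  {c | (∃ a, ∀ x, x ∈ c.1 ↔ π.SameCycle a x) ∧
    c.2 = fun x => if x ∈ c.1 then π x else x}

/-- The number of cycles (orbits) of a permutation of `Fin n`, counting fixed points
as 1-cycles. -/
noncomputable def Equiv.Perm.numCycles {n : ℕ} (π : Equiv.Perm (Fin n)) : ℕ :=
  π.cycleSet.ncard

/-- The unsigned Stirling number of the first kind `[n, k]`: the number of
permutations of an `n`-element set with exactly `k` cycles. -/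
noncomputable def stirlingFirst (n k : ℕ) : ℕ :=
  Nat.card {π : Equiv.Perm (Fin n) // π.numCycles = k}

namespace Equiv.Perm

variable {α : Type*}

/-- The number of orbits of a permutation, counting fixed points. -/
noncomputable def orbitCount (π : Equiv.Perm α) : ℕ :=
  Nat.card (Quotient (SameCycle.setoid π))

theorem SameCycle.map_eq_of_invariant {γ : Type*} {π : Equiv.Perm α} {f : α → γ}
    (hf : ∀ x, f (π x) = f x) {x y : α} (h : π.SameCycle x y) : f x = f y := by
  obtain ⟨i, rfl⟩ := h
  have hinv : ∀ x, f (π⁻¹ x) = f x := fun x => by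
    rw [← hf (π⁻¹ x), ← mul_apply, mul_inv_cancel, one_apply]
  induction i with
  | zero => simp
  | succ i ih => rw [ih, add_comm, zpow_add, mul_apply, zpow_one, hf]
  | pred i ih => rw [ih, sub_eq_neg_add, zpow_add, mul_apply, zpow_neg_one, hinv]

theorem SameCycle.map_of_sameCycle_apply {β : Type*} {σ : Equiv.Perm α} {π : Equiv.Perm β}
    {g : α → β} (hg : ∀ x, π.SameCycle (g (σ x)) (g x)) {x y : α} (h : σ.SameCycle x y) :
    π.SameCycle (g x) (g y) := by
  have := h.map_eq_of_invariant (f := fun x => Quotient.mk (SameCycle.setoid π) (g x))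
    (fun x => Quotient.sound (hg x))
  exact Quotient.exact this

theorem orbitCount_eq_card {γ : Type*} {π : Equiv.Perm α} (f : α → γ) (g : γ → α)
    (hf : ∀ x, f (π x) = f x) (hfg : ∀ c, f (g c) = c) (hgf : ∀ x, π.SameCycle (g (f x)) x) :
    π.orbitCount = Nat.card γ :=
  Nat.card_congr
    { toFun := Quotient.lift f fun _ _ h => SameCycle.map_eq_of_invariant hf h
      invFun := fun c => Quotient.mk _ (g c)
      left_inv := fun q => Quotient.inductionOn q fun x => Quotient.sound (hgf x)
      right_inv := hfg }

theorem orbitCount_eq_ncard_range {γ : Type*} {π : Equiv.Perm α} (f : α → γ)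
    (hf : ∀ x y, f x = f y ↔ π.SameCycle x y) : π.orbitCount = (Set.range f).ncard := by
  rw [← Nat.card_coe_set_eq]
  refine orbitCount_eq_card (Set.rangeFactorization f) (fun c => c.2.choose) ?_ ?_ ?_
  · exact fun x => Subtype.ext ((hf _ _).2 (sameCycle_apply_left.2 (SameCycle.refl π x)))
  · exact fun c => Subtype.ext c.2.choose_spec
  · exact fun x => (hf _ _).1 (Set.rangeFactorization f x).2.choose_spec

theorem sameCycle_out (π : Equiv.Perm α) (x : α) :
    π.SameCycle (Quotient.mk (SameCycle.setoid π) x).out x :=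
  Quotient.mk_out (s := SameCycle.setoid π) x

theorem mk_apply_eq (π : Equiv.Perm α) (x : α) :
    Quotient.mk (SameCycle.setoid π) (π x) = Quotient.mk (SameCycle.setoid π) x :=
  Quotient.sound (s := SameCycle.setoid π) (sameCycle_apply_left.2 (SameCycle.refl π x))

theorem orbitCount_permCongr {β : Type*} (e : α ≃ β) (π : Equiv.Perm α) :
    (e.permCongr π).orbitCount = π.orbitCount := by
  refine orbitCount_eq_card (fun x => Quotient.mk (SameCycle.setoid π) (e.symm x))
    (fun c => e c.out) ?_ ?_ ?_
  · intro x
    simpa using mk_apply_eq π (e.symm x)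
  · simp
  · intro x
    have := (sameCycle_out π (e.symm x)).map_of_sameCycle_apply (π := e.permCongr π) (g := e)
      (fun y => by
        have : e (π y) = e.permCongr π (e y) := by simp
        rw [this]
        exact sameCycle_apply_left.2 (SameCycle.refl _ _))
    simpa using this

theorem orbitCount_decomposeOption_symm_none [DecidableEq α] [Finite α] (σ : Equiv.Perm α) :
    (decomposeOption.symm (none, σ)).orbitCount = σ.orbitCount + 1 := by
  rw [orbitCount.eq_def σ, ← Finite.card_option]
  refine orbitCount_eq_card (Option.map (Quotient.mk (SameCycle.setoid σ)))
    (Option.map Quotient.out) ?_ ?_ ?_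
  · rintro (_ | x)
    · simp
    · simpa using mk_apply_eq σ x
  · rintro (_ | x) <;> simp
  · rintro (_ | x)
    · exact SameCycle.refl _ _
    · refine (sameCycle_out σ x).map_of_sameCycle_apply (g := some) fun y => ?_
      have : some (σ y) = decomposeOption.symm (none, σ) (some y) := by simp
      rw [this]
      exact sameCycle_apply_left.2 (SameCycle.refl _ _)

theorem orbitCount_decomposeOption_symm_some [DecidableEq α] (a : α) (σ : Equiv.Perm α) :
    (decomposeOption.symm (some a, σ)).orbitCount = σ.orbitCount := by
  set π := decomposeOption.symm (some a, σ) with hπ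
  have hnone : π none = some a := by simp [hπ]
  have hsome_eq : ∀ x, σ x = a → π (some x) = none := fun x hx => by simp [hπ, hx]
  have hsome_ne : ∀ x, σ x ≠ a → π (some x) = some (σ x) := fun x hx => by
    simp [hπ, swap_apply_of_ne_of_ne, hx]
  have hself : ∀ x, π.SameCycle (π x) x := fun x => sameCycle_apply_left.2 (SameCycle.refl π x)
  have hlift : ∀ x, π.SameCycle (some (σ x)) (some x) := by
    intro x
    by_cases hx : σ x = a
    · have h := (hself (π (some x))).trans (hself (some x))
      rwa [hsome_eq x hx, hnone, ← hx] at h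
    · rw [← hsome_ne x hx]
      exact hself _
  have hout : ∀ x, π.SameCycle (some (Quotient.mk (SameCycle.setoid σ) x).out) (some x) :=
    fun x => (sameCycle_out σ x).map_of_sameCycle_apply (g := some) hlift
  refine orbitCount_eq_card (fun x => Quotient.mk (SameCycle.setoid σ) (x.getD a))
    (fun c => some c.out) ?_ ?_ ?_
  · rintro (_ | x)
    · simp [hnone]
    · by_cases hx : σ x = a
      · rw [hsome_eq x hx]
        simpa [hx] using mk_apply_eq σ x
      · rw [hsome_ne x hx]
        exact mk_apply_eq σ x
  · simp
  · rintro (_ | x)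
    · have h := hself none
      rw [hnone] at h
      exact (hout a).trans h
    · exact hout x

theorem card_orbitCount_eq (α : Type*) [Finite α] (k : ℕ) :
    Nat.card {π : Equiv.Perm α // π.orbitCount = k} = Nat.stirlingFirst (Nat.card α) k := by
  classical
  revert k
  induction α using Finite.induction_empty_option with
  | of_equiv e ih =>
    intro k
    rw [← Nat.card_congr e, ← ih]
    exact (Nat.card_congr (e.permCongr.subtypeEquiv fun π => by
      rw [orbitCount_permCongr])).symm
  | h_empty =>
    intro k
    have h0 : ∀ π : Equiv.Perm PEmpty, π.orbitCount = 0 := fun π => by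
      have : IsEmpty (Quotient (SameCycle.setoid π)) := Quotient.instIsEmpty
      exact Nat.card_of_isEmpty
    cases k with
    | zero =>
      rw [Nat.card_congr (Equiv.subtypeUnivEquiv h0)]
      simp
    | succ k =>
      have : IsEmpty {π : Equiv.Perm PEmpty // π.orbitCount = k + 1} :=
        ⟨fun π => by have := π.2; rw [h0] at this; omega⟩
      rw [Nat.card_of_isEmpty]
      simp
  | @h_option β _ ih =>
    intro k
    have e : {π : Equiv.Perm (Option β) // π.orbitCount = k} ≃
        Σ i : Option β, {σ : Equiv.Perm β // (decomposeOption.symm (i, σ)).orbitCount = k} :=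
      (decomposeOption.subtypeEquiv (q := fun p => (decomposeOption.symm p).orbitCount = k)
        fun π => by rw [Equiv.symm_apply_apply]).trans
        (Equiv.subtypeProdEquivSigmaSubtype
          fun i σ => (decomposeOption.symm (i, σ)).orbitCount = k)
    rw [Nat.card_congr e, Nat.card_sigma, Fintype.sum_option]
    simp only [orbitCount_decomposeOption_symm_none, orbitCount_decomposeOption_symm_some, ih,
      Finite.card_option, Finset.sum_const, Finset.card_univ, smul_eq_mul]
    cases k with
    | zero =>
      rcases Nat.eq_zero_or_pos (Nat.card β) with h | h
      · simp [← Nat.card_eq_fintype_card, h]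
      · obtain ⟨m, hm⟩ := Nat.exists_eq_add_of_le' h
        simp [← Nat.card_eq_fintype_card, hm]
    | succ k =>
      simp only [add_left_inj, ih, ← Nat.card_eq_fintype_card, Nat.stirlingFirst_succ_succ]
      rw [add_comm]

section Cycles

variable {n : ℕ}

/-- The cycle of `π` through `a`. -/
noncomputable def cycleAt (π : Equiv.Perm (Fin n)) (a : Fin n) :
    Finset (Fin n) × (Fin n → Fin n) := by
  classical
  exact (Finset.univ.filter fun x => π.SameCycle a x, fun x => if π.SameCycle a x then π x else x)

theorem mem_cycleAt_fst {π : Equiv.Perm (Fin n)} {a x : Fin n} :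
    x ∈ (π.cycleAt a).1 ↔ π.SameCycle a x := by
  simp [cycleAt]

theorem cycleAt_eq_iff {π : Equiv.Perm (Fin n)} {a b : Fin n} :
    π.cycleAt a = π.cycleAt b ↔ π.SameCycle a b := by
  constructor
  · intro h
    rw [← mem_cycleAt_fst, h, mem_cycleAt_fst]
  · intro h
    have : ∀ x, π.SameCycle a x ↔ π.SameCycle b x :=
      fun x => ⟨fun hx => h.symm.trans hx, fun hx => h.trans hx⟩
    simp [cycleAt, this]

theorem cycleSet_eq_range (π : Equiv.Perm (Fin n)) : π.cycleSet = Set.range π.cycleAt := by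
  ext ⟨S, f⟩
  constructor
  · rintro ⟨⟨a, ha⟩, hf⟩
    refine ⟨a, Prod.ext (Finset.ext fun x => ?_) ?_⟩
    · rw [mem_cycleAt_fst, ha]
    · simp only at ha hf
      rw [hf]
      ext x
      simp [cycleAt, ha]
  · rintro ⟨a, ha⟩
    rw [← ha]
    refine ⟨⟨a, fun x => mem_cycleAt_fst⟩, ?_⟩
    ext x
    simp [cycleAt]

theorem numCycles_eq_orbitCount (π : Equiv.Perm (Fin n)) : π.numCycles = π.orbitCount := by
  rw [numCycles, cycleSet_eq_range, ← orbitCount_eq_ncard_range _ fun _ _ => cycleAt_eq_iff]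

theorem eq_cycleAt_of_mem {π : Equiv.Perm (Fin n)} {c : Finset (Fin n) × (Fin n → Fin n)}
    (hc : c ∈ π.cycleSet) {x : Fin n} (hx : x ∈ c.1) : c = π.cycleAt x := by
  rw [cycleSet_eq_range] at hc
  obtain ⟨a, rfl⟩ := hc
  exact cycleAt_eq_iff.2 (mem_cycleAt_fst.1 hx)

/-- Permutations with a prescribed set of `r` cycles are counted by Stirling numbers on the
complement of the `m ≥ r` points covered by these cycles. -/
theorem exists_card_superset_le_stirlingFirst {r : ℕ} (k : ℕ)
    (C : Set (Finset (Fin n) × (Fin n → Fin n))) (hC : C.ncard = r) :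
    ∃ m, r ≤ m ∧ {π : Equiv.Perm (Fin n) | π.numCycles = k ∧ C ⊆ π.cycleSet}.ncard ≤
      Nat.stirlingFirst (n - m) (k - r) := by
  classical
  by_cases hne : ∃ π : Equiv.Perm (Fin n), C ⊆ π.cycleSet
  swap
  · refine ⟨r, le_rfl, ?_⟩
    have : {π : Equiv.Perm (Fin n) | π.numCycles = k ∧ C ⊆ π.cycleSet} = ∅ := by
      ext π
      simpa using fun _ h => hne ⟨π, h⟩
    simp [this]
  let U : Set (Fin n) := {x | ∃ c ∈ C, x ∈ c.1}
  have hmem : ∀ π : Equiv.Perm (Fin n), C ⊆ π.cycleSet → ∀ x, x ∈ U ↔ π.cycleAt x ∈ C := by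
    intro π hπ x
    constructor
    · rintro ⟨c, hc, hx⟩
      rwa [← eq_cycleAt_of_mem (hπ hc) hx]
    · exact fun h => ⟨_, h, mem_cycleAt_fst.2 (SameCycle.refl _ _)⟩
  have himage : ∀ π : Equiv.Perm (Fin n), C ⊆ π.cycleSet → π.cycleAt '' U = C := by
    intro π hπ
    ext c
    constructor
    · rintro ⟨x, hx, rfl⟩
      exact (hmem π hπ x).1 hx
    · intro hc
      have := hπ hc
      rw [cycleSet_eq_range] at this
      obtain ⟨x, rfl⟩ := this
      exact ⟨x, (hmem π hπ x).2 hc, rfl⟩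
  have hstable : ∀ π : Equiv.Perm (Fin n), C ⊆ π.cycleSet → ∀ x, π x ∉ U ↔ x ∉ U := by
    intro π hπ x
    rw [hmem π hπ, hmem π hπ, cycleAt_eq_iff.2 (sameCycle_apply_left.2 (SameCycle.refl π x))]
  have hcount : ∀ (π : Equiv.Perm (Fin n)) (hπ : C ⊆ π.cycleSet), π.numCycles = k →
      (π.subtypePerm (p := fun x => x ∉ U) (hstable π hπ)).orbitCount = k - r := by
    intro π hπ hk
    rw [orbitCount_eq_ncard_range (fun x => π.cycleAt x.1)
      (fun x y => by rw [cycleAt_eq_iff, sameCycle_subtypePerm]), ← hk, ← hC, numCycles,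
      ← Set.ncard_sdiff hπ]
    congr 1
    ext c
    rw [cycleSet_eq_range]
    constructor
    · rintro ⟨x, rfl⟩
      exact ⟨⟨_, rfl⟩, fun h => x.2 ((hmem π hπ x).2 h)⟩
    · rintro ⟨⟨x, rfl⟩, hx⟩
      exact ⟨⟨x, fun h => hx ((hmem π hπ x).1 h)⟩, rfl⟩
  have hagree : ∀ π : Equiv.Perm (Fin n), C ⊆ π.cycleSet → ∀ c ∈ C, ∀ x ∈ c.1, c.2 x = π x := by
    intro π hπ c hc x hx
    rw [(hπ hc).2]
    simp [hx]
  refine ⟨U.ncard, ?_, ?_⟩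
  · obtain ⟨π, hπ⟩ := hne
    rw [← hC, ← himage π hπ]
    exact Set.ncard_image_le U.toFinite
  · have hcard : Nat.card {x // x ∉ U} = n - U.ncard := by
      have := Set.ncard_compl U
      rw [Nat.card_fin] at this
      rw [← this, ← Nat.card_coe_set_eq]
      rfl
    rw [← hcard, ← card_orbitCount_eq, ← Nat.card_coe_set_eq]
    refine Nat.card_le_card_of_injective
      (fun π => ⟨π.1.subtypePerm (p := fun x => x ∉ U) (hstable π.1 π.2.2), hcount π.1 π.2.2 π.2.1⟩) ?_
    rintro ⟨π, hk, hπ⟩ ⟨ρ, hl, hρ⟩ h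
    refine Subtype.ext (Equiv.ext fun x => ?_)
    by_cases hx : x ∈ U
    · obtain ⟨c, hc, hx⟩ := hx
      exact (hagree π hπ c hc x hx).symm.trans (hagree ρ hρ c hc x hx)
    · have := congrArg (fun τ => ((τ.1 ⟨x, hx⟩ : {x // x ∉ U}) : Fin n)) h
      simpa using this

end Cycles

end Equiv.Perm

theorem stirlingFirst_eq_nat_stirlingFirst (n k : ℕ) :
    stirlingFirst n k = Nat.stirlingFirst n k := by
  rw [stirlingFirst]
  simp only [Equiv.Perm.numCycles_eq_orbitCount, Equiv.Perm.card_orbitCount_eq, Nat.card_fin]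

namespace Nat

theorem stirlingFirst_le_succ_left (n k : ℕ) :
    Nat.stirlingFirst n (k + 1) ≤ Nat.stirlingFirst (n + 1) (k + 1) := by
  cases n with
  | zero => simp
  | succ n =>
    rw [Nat.stirlingFirst_succ_succ (n + 1)]
    exact (Nat.le_mul_of_pos_left _ n.succ_pos).trans (Nat.le_add_right _ _)

theorem stirlingFirst_mono_left (k : ℕ) : Monotone fun n => Nat.stirlingFirst n (k + 1) :=
  monotone_nat_of_le_succ fun n => stirlingFirst_le_succ_left n k

theorem stirlingFirst_pos {n k : ℕ} (h : k + 1 ≤ n) : 0 < Nat.stirlingFirst n (k + 1) := by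
  have := stirlingFirst_mono_left k h
  simp only [Nat.stirlingFirst_self] at this
  exact this

theorem stirlingFirst_zero_right_le_one (n : ℕ) : Nat.stirlingFirst n 0 ≤ 1 := by
  cases n <;> simp

theorem stirlingFirst_le_add_one {m n : ℕ} (h : m ≤ n) (k : ℕ) :
    Nat.stirlingFirst m k ≤ Nat.stirlingFirst n k + 1 := by
  cases k with
  | zero => exact (stirlingFirst_zero_right_le_one m).trans (Nat.le_add_left _ _)
  | succ k => exact (stirlingFirst_mono_left k h).trans (Nat.le_add_right _ _)

theorem stirlingFirst_le_factorial_mul (k n : ℕ) (h : k + 1 ≤ n) :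
    Nat.stirlingFirst n k ≤ (k + 1).factorial * Nat.stirlingFirst n (k + 1) := by
  induction k generalizing n with
  | zero =>
    obtain ⟨n, rfl⟩ := Nat.exists_eq_add_of_le' h
    simp
  | succ k ihk =>
    induction n, h using Nat.le_induction with
    | base =>
      rw [Nat.stirlingFirst_self, Nat.stirlingFirst_succ_self_left, mul_one]
      have h := Nat.choose_mul_factorial_mul_factorial (n := k + 1 + 1) (k := 2) (by omega)
      rw [← h, mul_assoc]
      exact Nat.le_mul_of_pos_right _ (Nat.mul_pos (Nat.factorial_pos _) (Nat.factorial_pos _))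
    | succ n hn ih =>
      rw [Nat.stirlingFirst_succ_succ n k, Nat.stirlingFirst_succ_succ n (k + 1), mul_add]
      refine Nat.add_le_add ?_ ((ihk n (by omega)).trans ?_)
      · rw [mul_left_comm]
        exact Nat.mul_le_mul_left _ ih
      · exact Nat.mul_le_mul_right _ (Nat.factorial_le (by omega))

theorem mul_stirlingFirst_add_one_le {n k B : ℕ} (hk : k + 1 ≤ n)
    (hn : B * ((k + 1).factorial + 1) ≤ n) :
    B * (Nat.stirlingFirst n k + 1) ≤ Nat.stirlingFirst (n + 1) (k + 1) := by
  have h1 := stirlingFirst_le_factorial_mul k n hk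
  have h2 := stirlingFirst_pos hk
  rw [Nat.stirlingFirst_succ_succ]
  calc B * (Nat.stirlingFirst n k + 1)
      ≤ B * ((k + 1).factorial * Nat.stirlingFirst n (k + 1) + Nat.stirlingFirst n (k + 1)) :=
        Nat.mul_le_mul_left _ (Nat.add_le_add h1 h2)
    _ = B * ((k + 1).factorial + 1) * Nat.stirlingFirst n (k + 1) := by ring
    _ ≤ n * Nat.stirlingFirst n (k + 1) := Nat.mul_le_mul_right _ hn
    _ ≤ _ := Nat.le_add_right _ _

end Nat

/-- **Erdős–Ko–Rado for permutations with a fixed number of cycles (bound).**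
Given positive integers `k, t` with `k ≥ t + 1`, there exists `n₀ = n₀(k, t)` such
that for all `n ≥ n₀`, every `t`-intersecting family `A ⊆ S_{n,k}` satisfies
`|A| ≤ [n - t, k - t]`. -/
theorem stmt0 (k t : ℕ) (hk : 0 < k) (ht : 0 < t) (hkt : t + 1 ≤ k) :
    ∃ n₀ : ℕ, ∀ n : ℕ, n₀ ≤ n →
      ∀ A : Set (Equiv.Perm (Fin n)),
        (∀ π ∈ A, π.numCycles = k) →
        (∀ π₁ ∈ A, ∀ π₂ ∈ A, t ≤ (π₁.cycleSet ∩ π₂.cycleSet).ncard) →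
        A.ncard ≤ stirlingFirst (n - t) (k - t) := by
  classical
  obtain ⟨j, rfl⟩ := Nat.exists_eq_add_of_le hkt
  set B := (t + 1 + j).choose t * (t + 1 + j) with hB
  refine ⟨t + 1 + (j + 1) + B * ((j + 1).factorial + 1), fun n hn A hA hint => ?_⟩
  rw [stirlingFirst_eq_nat_stirlingFirst, show t + 1 + j - t = j + 1 by omega]
  rcases A.eq_empty_or_nonempty with rfl | ⟨π₁, hπ₁⟩
  · simp
  have hfin : ∀ π : Equiv.Perm (Fin n), π.cycleSet.Finite := fun π => Set.toFinite _
  let M : Equiv.Perm (Fin n) → Finset (Finset (Fin n) × (Fin n → Fin n)) :=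
    fun π => (hfin π).toFinset
  have hMcoe : ∀ π, (M π : Set _) = π.cycleSet := fun π => (hfin π).coe_toFinset
  have hMcard : ∀ π ∈ A, (M π).card = t + 1 + j := fun π hπ => by
    rw [← hA π hπ, Equiv.Perm.numCycles, ← hMcoe, Set.ncard_coe_finset]
  have hMint : ∀ π ∈ A, ∀ ρ ∈ A, t ≤ (M π ∩ M ρ).card := fun π hπ ρ hρ => by
    rw [← Set.ncard_coe_finset, Finset.coe_inter, hMcoe, hMcoe]
    exact hint π hπ ρ hρ
  let F : Finset (Finset (Fin n) × (Fin n → Fin n)) → Finset (Equiv.Perm (Fin n)) :=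
    fun C => {π | π.numCycles = t + 1 + j ∧ C ⊆ M π}
  have hF : ∀ C, ∃ m, C.card ≤ m ∧
      (F C).card ≤ Nat.stirlingFirst (n - m) (t + 1 + j - C.card) := by
    intro C
    obtain ⟨m, hm, h⟩ := Equiv.Perm.exists_card_superset_le_stirlingFirst (t + 1 + j)
      (C : Set (Finset (Fin n) × (Fin n → Fin n))) (Set.ncard_coe_finset C)
    refine ⟨m, hm, ?_⟩
    convert h
    rw [← Set.ncard_coe_finset]
    congr 1
    ext π
    simp [F, ← hMcoe]
  by_cases htriv : ∃ T ∈ (M π₁).powersetCard t, ∀ π ∈ A, T ⊆ M π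
  · obtain ⟨T, hT, hTA⟩ := htriv
    rw [Finset.mem_powersetCard] at hT
    obtain ⟨m, hm, h⟩ := hF T
    rw [hT.2, show t + 1 + j - t = j + 1 by omega] at h
    have hsub : A ⊆ (F T : Set (Equiv.Perm (Fin n))) := fun π hπ => by
      simpa [F] using ⟨hA π hπ, hTA π hπ⟩
    calc A.ncard ≤ (F T).card := by
          rw [← Set.ncard_coe_finset]
          exact Set.ncard_le_ncard hsub (Finset.finite_toSet _)
      _ ≤ _ := h.trans (Nat.stirlingFirst_mono_left j (by omega))
  push Not at htriv
  choose! ρ hρA hρ using htriv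
  have hsub : A ⊆ (((M π₁).powersetCard t).biUnion fun T =>
      (M (ρ T) \ T).biUnion fun c => F (insert c T) : Finset (Equiv.Perm (Fin n))) := by
    intro π hπ
    obtain ⟨T, hTsub, hTcard⟩ := Finset.exists_subset_card_eq (hMint π₁ hπ₁ π hπ)
    have hTmem : T ∈ (M π₁).powersetCard t :=
      Finset.mem_powersetCard.2 ⟨hTsub.trans Finset.inter_subset_left, hTcard⟩
    have hTπ : T ⊆ M π := hTsub.trans Finset.inter_subset_right
    obtain ⟨c, hc, hcT⟩ : ∃ c ∈ M π ∩ M (ρ T), c ∉ T := by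
      by_contra! hcon
      have heq := Finset.eq_of_subset_of_card_le hcon
        (hTcard.trans_le (hMint π hπ (ρ T) (hρA T hTmem)))
      exact hρ T hTmem (heq.symm.subset.trans Finset.inter_subset_right)
    rw [Finset.mem_inter] at hc
    rw [Finset.mem_coe, Finset.mem_biUnion]
    refine ⟨T, hTmem, Finset.mem_biUnion.2 ⟨c, Finset.mem_sdiff.2 ⟨hc.2, hcT⟩, ?_⟩⟩
    simpa [F] using ⟨hA π hπ, Finset.insert_subset hc.1 hTπ⟩
  calc A.ncard ≤ (((M π₁).powersetCard t).biUnion fun T =>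
          (M (ρ T) \ T).biUnion fun c => F (insert c T)).card := by
        have := Set.ncard_le_ncard hsub (Finset.finite_toSet _)
        rwa [Set.ncard_coe_finset] at this
    _ ≤ ((M π₁).powersetCard t).card *
          ((t + 1 + j) * (Nat.stirlingFirst (n - t - 1) j + 1)) := by
        refine Finset.card_biUnion_le_card_mul _ _ _ fun T hT => ?_
        refine (Finset.card_biUnion_le_card_mul _ _
          (Nat.stirlingFirst (n - t - 1) j + 1) fun c hc => ?_).trans
          (Nat.mul_le_mul_right _ ((Finset.card_le_card Finset.sdiff_subset).trans
            (hMcard _ (hρA T hT)).le))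
        obtain ⟨m, hm, h⟩ := hF (insert c T)
        rw [Finset.card_insert_of_notMem (Finset.mem_sdiff.1 hc).2,
          (Finset.mem_powersetCard.1 hT).2] at hm h
        rw [show t + 1 + j - (t + 1) = j by omega] at h
        exact h.trans (Nat.stirlingFirst_le_add_one (by omega) j)
    _ = B * (Nat.stirlingFirst (n - t - 1) j + 1) := by
        rw [Finset.card_powersetCard, hMcard π₁ hπ₁, hB, mul_assoc]
    _ ≤ _ := by
        have h := Nat.mul_stirlingFirst_add_one_le (n := n - t - 1) (k := j) (B := B)
          (by omega) (by omega)
        rwa [show n - t - 1 + 1 = n - t by omega] at h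
end

section
/- Given positive integers k and t with k ≥ t+1, there exists an integer n₀ = n₀(k,t) such that for all n ≥ n₀, if A ⊆ S_{n,k} is t-intersecting and |A| = [n-t, k-t], then A is the stabiliser of t fixed points, i.e., there exists a t-element subset X ⊆ [n] such that A = {π ∈ S_{n,k} : π(x) = x for all x ∈ X}. -/
namespace Equiv.Perm

/-- The set of orbits of a permutation. -/
def orbitSet {α : Type*} (π : Perm α) : Set (Set α) :=
  Set.range fun a => {x | π.SameCycle a x}

theorem nonempty_of_mem_orbitSet {α : Type*} {π : Perm α} {s : Set α} (hs : s ∈ π.orbitSet) :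
    s.Nonempty := by
  obtain ⟨a, rfl⟩ := hs
  exact ⟨a, SameCycle.refl _ _⟩

theorem eq_orbit_of_mem {α : Type*} {π : Perm α} {s : Set α} (hs : s ∈ π.orbitSet) {a : α}
    (ha : a ∈ s) : s = {x | π.SameCycle a x} := by
  obtain ⟨b, rfl⟩ := hs
  ext x
  exact ⟨fun h => SameCycle.trans (SameCycle.symm ha) h, fun h => SameCycle.trans ha h⟩

/-- A relation between orbits along a surjection gives equal numbers of orbits. -/
theorem ncard_orbitSet_eq_of_surjective {α β : Type*} {σ : Perm β} {π : Perm α} {r : β → α}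
    (hr : Function.Surjective r)
    (h : ∀ x y, σ.SameCycle x y ↔ π.SameCycle (r x) (r y)) :
    σ.orbitSet.ncard = π.orbitSet.ncard := by
  have : σ.orbitSet = _root_.Set.preimage r '' π.orbitSet := by
    ext s
    constructor
    · rintro ⟨a, rfl⟩
      exact ⟨_, ⟨r a, rfl⟩, Set.ext fun x => (h a x).symm⟩
    · rintro ⟨_, ⟨a, rfl⟩, rfl⟩
      obtain ⟨b, rfl⟩ := hr a
      exact ⟨b, Set.ext fun x => h b x⟩
  rw [this, Set.ncard_image_of_injective _ hr.preimage_injective]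

/-- To map orbits to orbits it suffices to do so for single steps. -/
theorem SameCycle.of_step {α β : Type*} {σ : Perm β} {π : Perm α} {r : β → α}
    (h : ∀ x, π.SameCycle (r x) (r (σ x))) {x y : β} (hxy : σ.SameCycle x y) :
    π.SameCycle (r x) (r y) := by
  obtain ⟨i, rfl⟩ := hxy
  induction i with
  | zero => exact SameCycle.refl _ _
  | succ i ih =>
    rw [add_comm, zpow_add, zpow_one, mul_apply]
    exact ih.trans (h _)
  | pred i ih =>
    refine ih.trans (SameCycle.symm ?_)
    have := h ((σ ^ (-(i : ℤ) - 1)) x)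
    rwa [← mul_apply, ← zpow_one_add, add_sub_cancel] at this

theorem ncard_orbitSet_permCongr {α β : Type*} (e : α ≃ β) (π : Perm α) :
    (e.permCongr π).orbitSet.ncard = π.orbitSet.ncard := by
  refine ncard_orbitSet_eq_of_surjective (r := e.symm) e.symm.surjective fun x y =>
    ⟨fun h => h.of_step fun x => ?_, fun h => ?_⟩
  · simp [SameCycle.refl]
  · have := h.of_step (r := e) (σ := π) (π := e.permCongr π) fun x => by
      have h1 : e (π x) = e.permCongr π (e x) := by simp
      rw [h1, sameCycle_apply_right]
    simpa using this

theorem ncard_orbitSet_decomposeOption_symm_some {α : Type*} [DecidableEq α] (a : α)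
    (π : Perm α) :
    (decomposeOption.symm (some a, π)).orbitSet.ncard = π.orbitSet.ncard := by
  set σ := decomposeOption.symm (some a, π) with hσ
  have h0 : σ none = some a := by simp [hσ]
  have h1 : ∀ x, π x = a → σ (some x) = none := fun x hx => by simp [hσ, hx]
  have h2 : ∀ x, π x ≠ a → σ (some x) = some (π x) := fun x hx => by
    simp [hσ, swap_apply_of_ne_of_ne, hx]
  have hr : ∀ z, σ.SameCycle z (some (z.getD a)) := by
    rintro (_ | x)
    · rw [Option.getD_none, ← h0, sameCycle_apply_right]
    · exact SameCycle.refl _ _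
  refine ncard_orbitSet_eq_of_surjective (r := fun z => z.getD a) (fun x => ⟨some x, rfl⟩)
    fun x y => ⟨fun h => ?_, fun h => ?_⟩
  · refine h.of_step (r := fun z => z.getD a) ?_
    rintro (_ | x)
    · simp [h0, SameCycle.refl]
    · by_cases hx : π x = a
      · rw [h1 x hx, Option.getD_none, ← hx, Option.getD_some, sameCycle_apply_right]
      · rw [h2 x hx, Option.getD_some, Option.getD_some, sameCycle_apply_right]
  · refine (hr x).trans (SameCycle.trans ?_ (hr y).symm)
    refine h.of_step (r := some) fun x => ?_
    by_cases hx : π x = a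
    · rw [hx, ← h0, sameCycle_apply_right, ← h1 x hx, sameCycle_apply_right]
    · rw [← h2 x hx, sameCycle_apply_right]

theorem ncard_orbitSet_decomposeOption_symm_none {α : Type*} [DecidableEq α] [Finite α]
    (π : Perm α) :
    (decomposeOption.symm (none, π)).orbitSet.ncard = π.orbitSet.ncard + 1 := by
  set σ := decomposeOption.symm (none, π) with hσ
  have h0 : σ none = none := by simp [hσ]
  have h1 : ∀ x, σ (some x) = some (π x) := fun x => by simp [hσ]
  have key : ∀ x y, σ.SameCycle (some x) (some y) ↔ π.SameCycle x y := by
    refine fun x y => ⟨?_, fun h => h.of_step (r := some) fun x => ?_⟩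
    · intro h
      refine h.of_step (r := fun z => z.getD x) ?_
      rintro (_ | z)
      · simp [h0, SameCycle.refl]
      · simp [h1, SameCycle.refl]
    · rw [← h1, sameCycle_apply_right]
  have hn : ∀ x, ¬ σ.SameCycle none (some x) := fun x h => by
    simpa using h.eq_of_left h0
  have : σ.orbitSet = insert {none} ((_root_.Set.image some) '' π.orbitSet) := by
    ext s
    simp only [orbitSet, Set.mem_range, Set.mem_insert_iff, Set.mem_image, exists_exists_eq_and]
    rw [Option.exists]
    refine or_congr ?_ (exists_congr fun a => ?_)
    · rw [eq_comm]
      refine Eq.congr_right ?_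
      ext (_ | x)
      · simp [SameCycle.refl]
      · simp [hn]
    · refine Eq.congr_left ?_
      ext (_ | x)
      · simpa using fun h => hn a (SameCycle.symm h)
      · simp [key]
  rw [this, Set.ncard_insert_of_notMem, Set.ncard_image_of_injective]
  · exact Set.image_injective.2 (Option.some_injective α)
  · rintro ⟨s, -, hs⟩
    have : none ∈ some '' s := hs ▸ Set.mem_singleton _
    simp at this

theorem ncard_orbitSet_of_isEmpty {α : Type*} [IsEmpty α] (π : Perm α) :
    π.orbitSet.ncard = 0 := by
  rw [orbitSet, Set.range_eq_empty, Set.ncard_empty]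

/-- The number of permutations with exactly `k` orbits is a Stirling number of the first kind. -/
theorem card_ncard_orbitSet_eq (α : Type*) [Finite α] (k : ℕ) :
    Nat.card {π : Perm α // π.orbitSet.ncard = k} = Nat.stirlingFirst (Nat.card α) k := by
  induction α using Finite.induction_empty_option generalizing k with
  | of_equiv e ih =>
    rw [← Nat.card_congr e, ← ih]
    exact (Nat.card_congr (e.permCongr.subtypeEquiv fun π => by
      rw [ncard_orbitSet_permCongr])).symm
  | h_empty =>
    simp only [ncard_orbitSet_of_isEmpty, Nat.card_of_isEmpty (α := PEmpty)]
    cases k <;> simp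
  | @h_option α _ ih =>
    classical
    rw [Nat.card_congr (decomposeOption.subtypeEquiv
      (q := fun p => (decomposeOption.symm p).orbitSet.ncard = k) fun π => by
        rw [Equiv.symm_apply_apply]),
      Nat.card_congr (Equiv.subtypeProdEquivSigmaSubtype
        fun a π => (decomposeOption.symm (a, π)).orbitSet.ncard = k), Nat.card_sigma,
      Fintype.sum_option]
    simp only [ncard_orbitSet_decomposeOption_symm_some,
      ncard_orbitSet_decomposeOption_symm_none, ih, Finite.card_option, Finset.sum_const, Finset.card_univ,
      smul_eq_mul, ← Nat.card_eq_fintype_card]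
    cases k with
    | zero =>
      rw [Nat.stirlingFirst_succ_zero]
      rcases isEmpty_or_nonempty α with _ | _
      · simp
      · have : Nat.card α ≠ 0 := Nat.card_pos.ne'
        obtain ⟨m, hm⟩ := Nat.exists_eq_succ_of_ne_zero this
        simp [hm, -Nat.card_eq_fintype_card]
    | succ k =>
      rw [add_comm]
      simp only [Nat.add_right_cancel_iff, ih, Nat.stirlingFirst_succ_succ]

end Equiv.Perm

namespace Nat

theorem stirlingFirst_pos_s1 {n k : ℕ} (hk : 0 < k) (hkn : k ≤ n) : 0 < stirlingFirst n k := by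
  induction n, hkn using Nat.le_induction with
  | base => rw [stirlingFirst_self]; exact one_pos
  | succ n hn ih =>
    obtain ⟨k, rfl⟩ := Nat.exists_eq_add_of_le' hk
    rw [stirlingFirst_succ_succ]
    have : 0 < n := by omega
    positivity

theorem stirlingFirst_monotone {k : ℕ} (hk : 0 < k) :
    Monotone fun n => stirlingFirst n k := by
  refine monotone_nat_of_le_succ fun n => ?_
  obtain ⟨k, rfl⟩ := Nat.exists_eq_add_of_le' hk
  rcases n with _ | n
  · simp
  · rw [stirlingFirst_succ_succ (n + 1)]
    nlinarith [Nat.zero_le (stirlingFirst (n + 1) k),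
      Nat.zero_le (n * stirlingFirst (n + 1) (k + 1))]

/-- For fixed `k`, the Stirling number `[n, k]` is at most a constant multiple of `[n, k + 1]`. -/
theorem exists_stirlingFirst_le_mul_succ (k : ℕ) :
    ∃ a, ∀ n, k < n → stirlingFirst n k ≤ a * stirlingFirst n (k + 1) := by
  induction k with
  | zero =>
    refine ⟨0, fun n hn => ?_⟩
    obtain ⟨n, rfl⟩ := Nat.exists_eq_add_of_le' hn
    simp
  | succ k ih =>
    obtain ⟨a, ha⟩ := ih
    refine ⟨max a (stirlingFirst (k + 2) (k + 1)), fun n hn => ?_⟩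
    induction n, hn using Nat.le_induction with
    | base =>
      rw [stirlingFirst_self, mul_one]
      exact le_max_right _ _
    | succ n hn ih =>
      rw [stirlingFirst_succ_succ n k, stirlingFirst_succ_succ n (k + 1), mul_add, mul_left_comm]
      have h := ha n (by omega)
      gcongr
      exact h.trans (by gcongr; exact le_max_left _ _)

theorem exists_stirlingFirst_le_mul_succ_of_le (k : ℕ) :
    ∃ a, ∀ n, k < n → ∀ m ≤ n, stirlingFirst m k ≤ a * stirlingFirst n (k + 1) := by
  rcases Nat.eq_zero_or_pos k with rfl | hk
  · refine ⟨1, fun n hn m _ => ?_⟩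
    have h1 : stirlingFirst m 0 ≤ 1 := by cases m <;> simp
    have h2 : 0 < stirlingFirst n (0 + 1) := stirlingFirst_pos_s1 (by omega) hn
    omega
  · obtain ⟨a, ha⟩ := exists_stirlingFirst_le_mul_succ k
    exact ⟨a, fun n hn m hm => (stirlingFirst_monotone hk hm).trans (ha n hn)⟩

theorem mul_stirlingFirst_lt {c n k : ℕ} (hk : 0 < k) (hkn : k ≤ n) (hc : c < n) :
    c * stirlingFirst n k < stirlingFirst (n + 1) k := by
  obtain ⟨l, rfl⟩ := Nat.exists_eq_add_of_le' hk
  rw [stirlingFirst_succ_succ]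
  have := stirlingFirst_pos_s1 hk hkn
  nlinarith

end Nat

namespace Equiv.Perm

variable {n : ℕ} {π : Perm (Fin n)}

theorem coe_fst_mem_orbitSet {c : Finset (Fin n) × (Fin n → Fin n)} (hc : c ∈ π.cycleSet) :
    (c.1 : Set (Fin n)) ∈ π.orbitSet := by
  obtain ⟨⟨a, ha⟩, -⟩ := hc
  exact ⟨a, Set.ext fun x => (ha x).symm⟩

theorem injOn_coe_fst_cycleSet :
    Set.InjOn (fun c : Finset (Fin n) × (Fin n → Fin n) => (c.1 : Set (Fin n))) π.cycleSet := by
  rintro ⟨S, f⟩ ⟨-, hf⟩ ⟨S', f'⟩ ⟨-, hf'⟩ h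
  obtain rfl : S = S' := Finset.coe_injective h
  exact Prod.ext rfl (hf.trans hf'.symm)

theorem image_coe_fst_cycleSet :
    (fun c : Finset (Fin n) × (Fin n → Fin n) => (c.1 : Set (Fin n))) '' π.cycleSet =
      π.orbitSet := by
  classical
  refine Set.Subset.antisymm ?_ ?_
  · rintro _ ⟨c, hc, rfl⟩
    exact coe_fst_mem_orbitSet hc
  · rintro _ ⟨a, rfl⟩
    let S := Finset.univ.filter fun x => π.SameCycle a x
    exact ⟨(S, fun x => if x ∈ S then π x else x), ⟨⟨a, fun x => by simp [S]⟩, by ext; simp⟩,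
      by simp [S]⟩

theorem numCycles_eq_ncard_orbitSet (π : Perm (Fin n)) : π.numCycles = π.orbitSet.ncard := by
  rw [numCycles, ← image_coe_fst_cycleSet, injOn_coe_fst_cycleSet.ncard_image]

theorem snd_apply_of_mem_cycleSet {c : Finset (Fin n) × (Fin n → Fin n)} (hc : c ∈ π.cycleSet)
    {x : Fin n} (hx : x ∈ c.1) : c.2 x = π x := by
  rw [hc.2]
  exact if_pos hx

theorem apply_mem_fst_iff {c : Finset (Fin n) × (Fin n → Fin n)} (hc : c ∈ π.cycleSet)
    {x : Fin n} : π x ∈ c.1 ↔ x ∈ c.1 := by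
  obtain ⟨⟨a, ha⟩, -⟩ := hc
  rw [ha, ha, sameCycle_apply_right]

theorem disjoint_fst_of_mem_cycleSet {c d : Finset (Fin n) × (Fin n → Fin n)}
    (hc : c ∈ π.cycleSet) (hd : d ∈ π.cycleSet) (hcd : c ≠ d) : _root_.Disjoint c.1 d.1 := by
  rw [Finset.disjoint_left]
  intro x hxc hxd
  refine hcd (injOn_coe_fst_cycleSet hc hd ?_)
  exact (eq_orbit_of_mem (coe_fst_mem_orbitSet hc) hxc).trans
    (eq_orbit_of_mem (coe_fst_mem_orbitSet hd) hxd).symm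

variable {T : Finset (Finset (Fin n) × (Fin n → Fin n))}

theorem card_fst_pos_of_mem_cycleSet {c : Finset (Fin n) × (Fin n → Fin n)}
    (hc : c ∈ π.cycleSet) : 1 ≤ c.1.card :=
  Finset.card_pos.2 <| by simpa using nonempty_of_mem_orbitSet (coe_fst_mem_orbitSet hc)

theorem card_biUnion_fst (hT : ↑T ⊆ π.cycleSet) :
    (T.biUnion Prod.fst).card = ∑ c ∈ T, c.1.card :=
  Finset.card_biUnion fun _ hc _ hd h => disjoint_fst_of_mem_cycleSet (hT hc) (hT hd) h

theorem card_le_card_biUnion_fst (hT : ↑T ⊆ π.cycleSet) :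
    T.card ≤ (T.biUnion Prod.fst).card := by
  rw [card_biUnion_fst hT, Finset.card_eq_sum_ones]
  exact Finset.sum_le_sum fun c hc => card_fst_pos_of_mem_cycleSet (hT hc)

theorem apply_eq_self_of_card_biUnion_fst_eq (hT : ↑T ⊆ π.cycleSet)
    (h : (T.biUnion Prod.fst).card = T.card) {x : Fin n} (hx : x ∈ T.biUnion Prod.fst) :
    π x = x := by
  rw [card_biUnion_fst hT, Finset.card_eq_sum_ones, eq_comm,
    Finset.sum_eq_sum_iff_of_le fun c hc => card_fst_pos_of_mem_cycleSet (hT hc)] at h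
  obtain ⟨c, hc, hxc⟩ := Finset.mem_biUnion.1 hx
  obtain ⟨y, hy⟩ := Finset.card_eq_one.1 (h c hc).symm
  have h1 := (apply_mem_fst_iff (hT hc)).2 hxc
  rw [hy, Finset.mem_singleton] at hxc h1
  rw [h1, hxc]

theorem apply_mem_biUnion_fst_iff (hT : ↑T ⊆ π.cycleSet) (x : Fin n) :
    π x ∈ T.biUnion Prod.fst ↔ x ∈ T.biUnion Prod.fst := by
  simp only [Finset.mem_biUnion]
  exact exists_congr fun c => and_congr_right fun hc => apply_mem_fst_iff (hT hc)

/-- Removing the points of a set `T` of cycles removes exactly the orbits in `T`. -/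
theorem ncard_orbitSet_subtypePerm_add (hT : ↑T ⊆ π.cycleSet) :
    (π.subtypePerm (p := fun x => x ∉ T.biUnion Prod.fst)
      fun x => (apply_mem_biUnion_fst_iff hT x).not).orbitSet.ncard + T.card =
        π.orbitSet.ncard := by
  set τ := π.subtypePerm (p := fun x => x ∉ T.biUnion Prod.fst)
      fun x => (apply_mem_biUnion_fst_iff hT x).not
  have key : π.orbitSet = (_root_.Set.image Subtype.val '' τ.orbitSet) ∪
      (fun c : Finset (Fin n) × (Fin n → Fin n) => (c.1 : Set (Fin n))) '' (T : Set _) := by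
    have orb : ∀ a, Subtype.val '' {x | τ.SameCycle a x} = {x | π.SameCycle a x} := by
      intro a
      ext x
      constructor
      · rintro ⟨y, hy, rfl⟩
        exact sameCycle_subtypePerm.1 hy
      · intro hx
        refine ⟨⟨x, fun hxU => a.2 ?_⟩, sameCycle_subtypePerm.2 hx, rfl⟩
        obtain ⟨c, hc, hxc⟩ := Finset.mem_biUnion.1 hxU
        refine Finset.mem_biUnion.2 ⟨c, hc, ?_⟩
        have := eq_orbit_of_mem (coe_fst_mem_orbitSet (hT hc)) hxc
        rw [← Finset.mem_coe, this]
        exact SameCycle.symm hx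
    refine Set.Subset.antisymm ?_ (Set.union_subset ?_ ?_)
    · rintro _ ⟨a, rfl⟩
      by_cases ha : a ∈ T.biUnion Prod.fst
      · obtain ⟨c, hc, hac⟩ := Finset.mem_biUnion.1 ha
        exact Or.inr ⟨c, hc, eq_orbit_of_mem (coe_fst_mem_orbitSet (hT hc)) hac⟩
      · exact Or.inl ⟨_, ⟨⟨a, ha⟩, rfl⟩, orb _⟩
    · rintro _ ⟨_, ⟨a, rfl⟩, rfl⟩
      exact ⟨a, (orb a).symm⟩
    · rintro _ ⟨c, hc, rfl⟩
      exact coe_fst_mem_orbitSet (hT hc)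
  rw [key, Set.ncard_union_eq, Set.ncard_image_of_injective,
    (injOn_coe_fst_cycleSet.mono hT).ncard_image, Set.ncard_coe_finset]
  · exact Set.image_injective.2 Subtype.val_injective
  · rw [Set.disjoint_left]
    rintro _ ⟨s, hs, rfl⟩ ⟨c, hc, hcs⟩
    obtain ⟨y, hy⟩ := nonempty_of_mem_orbitSet hs
    have : (y : Fin n) ∈ (c.1 : Set (Fin n)) := hcs.symm.subset ⟨y, hy, rfl⟩
    exact y.2 (Finset.mem_biUnion.2 ⟨c, hc, this⟩)

/-- The number of permutations with `k` cycles containing a given set of cycles is bounded by the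
number of permutations of the remaining points with the remaining number of cycles. -/
theorem ncard_subset_cycleSet_le (T : Finset (Finset (Fin n) × (Fin n → Fin n))) (k : ℕ) :
    {π : Perm (Fin n) | π.numCycles = k ∧ ↑T ⊆ π.cycleSet}.ncard ≤
      Nat.stirlingFirst (n - (T.biUnion Prod.fst).card) (k - T.card) := by
  have hcard : Nat.card {x // x ∉ T.biUnion Prod.fst} = n - (T.biUnion Prod.fst).card := by
    rw [Nat.card_eq_fintype_card, Fintype.card_subtype_compl, Fintype.card_fin, Fintype.card_coe]
  rw [← hcard, ← card_ncard_orbitSet_eq, ← Nat.card_coe_set_eq]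
  refine Nat.card_le_card_of_injective (fun π => ⟨π.1.subtypePerm
      fun x => (apply_mem_biUnion_fst_iff π.2.2 x).not, ?_⟩) ?_
  · refine Nat.eq_sub_of_add_eq ?_
    rw [ncard_orbitSet_subtypePerm_add π.2.2, ← numCycles_eq_ncard_orbitSet, π.2.1]
  · rintro ⟨π, hπ⟩ ⟨σ, hσ⟩ h
    refine Subtype.ext (Equiv.ext fun x => ?_)
    by_cases hx : x ∈ T.biUnion Prod.fst
    · obtain ⟨c, hc, hxc⟩ := Finset.mem_biUnion.1 hx
      exact (snd_apply_of_mem_cycleSet (hπ.2 hc) hxc).symm.trans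
        (snd_apply_of_mem_cycleSet (hσ.2 hc) hxc)
    · have := congrArg Subtype.val (DFunLike.congr_fun (congrArg Subtype.val h) ⟨x, hx⟩)
      simpa using this

/-- The fixed points in `X`, encoded as cycles. -/
def fixedCycles (X : Finset (Fin n)) : Finset (Finset (Fin n) × (Fin n → Fin n)) :=
  X.image fun x => ({x}, id)

theorem card_fixedCycles (X : Finset (Fin n)) : (fixedCycles X).card = X.card :=
  Finset.card_image_of_injective _ fun x y h => by simpa using h

theorem biUnion_fst_fixedCycles (X : Finset (Fin n)) :
    (fixedCycles X).biUnion Prod.fst = X := by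
  simp [fixedCycles, Finset.image_biUnion, Finset.biUnion_singleton_eq_self]

theorem fixedCycles_subset_cycleSet {X : Finset (Fin n)} (h : ∀ x ∈ X, π x = x) :
    ↑(fixedCycles X) ⊆ π.cycleSet := by
  intro c hc
  obtain ⟨x, hx, rfl⟩ := Finset.mem_image.1 (Finset.mem_coe.1 hc)
  refine ⟨⟨x, fun y => ?_⟩, funext fun y => ?_⟩
  · rw [Finset.mem_singleton]
    exact ⟨fun hy => hy ▸ SameCycle.refl _ _, fun hy => (hy.eq_of_left (h x hx)).symm⟩
  · by_cases hy : y = x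
    · simp [hy, h x hx]
    · simp [hy]

end Equiv.Perm

/-- A family of the extremal size all of whose members contain a fixed set of `t` cycles is the
stabiliser of `t` points. -/
theorem exists_eq_stabiliser_of_subset_cycleSet {n k t : ℕ} (hkt : t < k) (hn : k + t + 2 ≤ n)
    {A : Set (Equiv.Perm (Fin n))} (hAk : ∀ π ∈ A, π.numCycles = k)
    {T : Finset (Finset (Fin n) × (Fin n → Fin n))} (hTt : T.card = t)
    (hTA : ∀ π ∈ A, ↑T ⊆ π.cycleSet) {π₀ : Equiv.Perm (Fin n)} (hπ₀ : π₀ ∈ A)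
    (hA : A.ncard = Nat.stirlingFirst (n - t) (k - t)) :
    ∃ X : Finset (Fin n), X.card = t ∧
      A = {π : Equiv.Perm (Fin n) | π.numCycles = k ∧ ∀ x ∈ X, π x = x} := by
  have hle : A.ncard ≤ Nat.stirlingFirst (n - (T.biUnion Prod.fst).card) (k - t) :=
    (Set.ncard_le_ncard (t := {π | π.numCycles = k ∧ ↑T ⊆ π.cycleSet})
      fun π hπ => ⟨hAk π hπ, hTA π hπ⟩).trans
        (hTt ▸ Equiv.Perm.ncard_subset_cycleSet_le T k)
  have hU : (T.biUnion Prod.fst).card = t := by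
    refine le_antisymm (not_lt.1 fun hlt => ?_)
      (hTt ▸ Equiv.Perm.card_le_card_biUnion_fst (hTA π₀ hπ₀))
    obtain ⟨N, hN⟩ : ∃ N, n - t = N + 1 := ⟨n - t - 1, by omega⟩
    have h1 := Nat.stirlingFirst_monotone (k := k - t) (by omega)
      (show n - (T.biUnion Prod.fst).card ≤ N by omega)
    have h2 := Nat.mul_stirlingFirst_lt (c := 1) (n := N) (k := k - t)
      (by omega) (by omega) (by omega)
    rw [hA, hN] at hle
    dsimp only at h1
    omega
  refine ⟨T.biUnion Prod.fst, hU, Set.eq_of_subset_of_ncard_le (fun π hπ => ⟨hAk π hπ, fun x hx =>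
    Equiv.Perm.apply_eq_self_of_card_biUnion_fst_eq (hTA π hπ) (hU.trans hTt.symm) hx⟩) ?_⟩
  rw [hA]
  refine (Set.ncard_le_ncard
    (t := {π | π.numCycles = k ∧ ↑(Equiv.Perm.fixedCycles (T.biUnion Prod.fst)) ⊆ π.cycleSet})
    fun π hπ => ⟨hπ.1, Equiv.Perm.fixedCycles_subset_cycleSet hπ.2⟩).trans
      ((Equiv.Perm.ncard_subset_cycleSet_le
        (Equiv.Perm.fixedCycles (T.biUnion Prod.fst)) k).trans_eq ?_)
  rw [Equiv.Perm.biUnion_fst_fixedCycles, Equiv.Perm.card_fixedCycles, hU]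

/-- A `t`-intersecting family with no `t` cycles common to all members is covered by few families
of permutations containing `t + 1` prescribed cycles. -/
theorem ncard_le_of_forall_not_subset {n k t b : ℕ} {A : Set (Equiv.Perm (Fin n))}
    (hAk : ∀ π ∈ A, π.numCycles = k)
    (hAt : ∀ π₁ ∈ A, ∀ π₂ ∈ A, t ≤ (π₁.cycleSet ∩ π₂.cycleSet).ncard)
    {π₀ : Equiv.Perm (Fin n)} (hπ₀ : π₀ ∈ A)
    (hT : ∀ T : Finset (Finset (Fin n) × (Fin n → Fin n)), T.card = t →
      ∃ π ∈ A, ¬ ↑T ⊆ π.cycleSet)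
    (hb : ∀ T : Finset (Finset (Fin n) × (Fin n → Fin n)), T.card = t + 1 →
      {π : Equiv.Perm (Fin n) | π.numCycles = k ∧ ↑T ⊆ π.cycleSet}.ncard ≤ b) :
    A.ncard ≤ k.choose t * k * b := by
  classical
  have hM : ∀ π : Equiv.Perm (Fin n), ∃ M : Finset (Finset (Fin n) × (Fin n → Fin n)),
      (M : Set _) = π.cycleSet := fun π => ⟨_, π.cycleSet.toFinite.coe_toFinset⟩
  choose M hM using hM
  have hMk : ∀ π ∈ A, (M π).card = k := fun π hπ => by
    rw [← Set.ncard_coe_finset, hM, ← hAk π hπ, Equiv.Perm.numCycles]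
  have hMt : ∀ π₁ ∈ A, ∀ π₂ ∈ A, t ≤ (M π₁ ∩ M π₂).card := fun π₁ h₁ π₂ h₂ => by
    rw [← Set.ncard_coe_finset, Finset.coe_inter, hM, hM]
    exact hAt π₁ h₁ π₂ h₂
  simp only [← hM, Finset.coe_subset] at hT hb
  choose! g hgA hg using hT
  have hcover : A ⊆ ⋃ T ∈ (M π₀).powersetCard t, ⋃ c ∈ M (g T) \ T,
      {π : Equiv.Perm (Fin n) | π.numCycles = k ∧ insert c T ⊆ M π} := by
    intro π hπ
    obtain ⟨T, hTs, hTt⟩ := Finset.exists_subset_card_eq (hMt π₀ hπ₀ π hπ)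
    obtain ⟨c, hc, hcT⟩ : ∃ c ∈ M (g T) ∩ M π, c ∉ T := by
      by_contra! h
      have h1 : M (g T) ∩ M π = T :=
        Finset.eq_of_subset_of_card_le h (hTt ▸ hMt _ (hgA T hTt) _ hπ)
      exact hg T hTt (h1.symm.subset.trans Finset.inter_subset_left)
    rw [Finset.mem_inter] at hc
    simp only [Set.mem_iUnion]
    exact ⟨T, Finset.mem_powersetCard.2 ⟨hTs.trans Finset.inter_subset_left, hTt⟩, c,
      Finset.mem_sdiff.2 ⟨hc.1, hcT⟩, hAk π hπ,
      Finset.insert_subset hc.2 (hTs.trans Finset.inter_subset_right)⟩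
  calc A.ncard ≤ _ := Set.ncard_le_ncard hcover
    _ ≤ _ := Finset.set_ncard_biUnion_le _ _
    _ ≤ ∑ T ∈ (M π₀).powersetCard t, k * b := by
        refine Finset.sum_le_sum fun T hT => (Finset.set_ncard_biUnion_le _ _).trans ?_
        rw [Finset.mem_powersetCard] at hT
        calc _ ≤ ∑ c ∈ M (g T) \ T, b := Finset.sum_le_sum fun c hc => hb _ <| by
              rw [Finset.card_insert_of_notMem (Finset.mem_sdiff.1 hc).2, hT.2]
          _ ≤ k * b := by
              rw [Finset.sum_const, smul_eq_mul]
              gcongr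
              exact (Finset.card_le_card Finset.sdiff_subset).trans_eq (hMk _ (hgA T hT.2))
    _ = k.choose t * k * b := by
        rw [Finset.sum_const, Finset.card_powersetCard, hMk π₀ hπ₀, smul_eq_mul, mul_assoc]

/-- **Erdős–Ko–Rado for permutations with a fixed number of cycles (uniqueness).**
Given positive integers `k, t` with `k ≥ t + 1`, there exists `n₀ = n₀(k, t)` such
that for all `n ≥ n₀`, every `t`-intersecting family `A ⊆ S_{n,k}` with
`|A| = [n - t, k - t]` is the stabiliser of `t` fixed points. -/
theorem stmt1 (k t : ℕ) (hk : 0 < k) (ht : 0 < t) (hkt : t + 1 ≤ k) :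
    ∃ n₀ : ℕ, ∀ n : ℕ, n₀ ≤ n →
      ∀ A : Set (Equiv.Perm (Fin n)),
        (∀ π ∈ A, π.numCycles = k) →
        (∀ π₁ ∈ A, ∀ π₂ ∈ A, t ≤ (π₁.cycleSet ∩ π₂.cycleSet).ncard) →
        A.ncard = stirlingFirst (n - t) (k - t) →
        ∃ X : Finset (Fin n), X.card = t ∧
          A = {π : Equiv.Perm (Fin n) | π.numCycles = k ∧ ∀ x ∈ X, π x = x} := by
  obtain ⟨a, ha⟩ := Nat.exists_stirlingFirst_le_mul_succ_of_le (k - (t + 1))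
  have hj : k - (t + 1) + 1 = k - t := by omega
  rw [hj] at ha
  refine ⟨k.choose t * k * a + k + t + 3, fun n hn A hAk hAt hA => ?_⟩
  rw [stirlingFirst_eq_nat_stirlingFirst] at hA
  obtain ⟨N, hN, hkN, hcN⟩ : ∃ N, n - t = N + 1 ∧ k ≤ N ∧ k.choose t * k * a < N :=
    ⟨n - t - 1, by omega, by omega, by omega⟩
  have hApos : 0 < A.ncard := hA ▸ Nat.stirlingFirst_pos_s1 (by omega) (by omega)
  obtain ⟨π₀, hπ₀⟩ := Set.nonempty_of_ncard_ne_zero hApos.ne'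
  by_cases hT : ∃ T : Finset (Finset (Fin n) × (Fin n → Fin n)), T.card = t ∧
      ∀ π ∈ A, ↑T ⊆ π.cycleSet
  · obtain ⟨T, hTt, hTA⟩ := hT
    exact exists_eq_stabiliser_of_subset_cycleSet (by omega) (by omega) hAk hTt hTA hπ₀ hA
  · push Not at hT
    refine absurd hA (ne_of_lt ?_)
    calc A.ncard ≤ k.choose t * k * (a * Nat.stirlingFirst N (k - t)) := by
          refine ncard_le_of_forall_not_subset hAk hAt hπ₀ hT fun T hTt => ?_
          rcases Set.eq_empty_or_nonempty
            {π : Equiv.Perm (Fin n) | π.numCycles = k ∧ ↑T ⊆ π.cycleSet} with h | ⟨π, -, hπ⟩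
          · simp [h]
          · have h1 := Equiv.Perm.card_le_card_biUnion_fst hπ
            refine (Equiv.Perm.ncard_subset_cycleSet_le T k).trans ?_
            rw [hTt] at h1 ⊢
            exact ha N (by omega) _ (by omega)
      _ = k.choose t * k * a * Nat.stirlingFirst N (k - t) := by ring
      _ < Nat.stirlingFirst (n - t) (k - t) := by
          rw [hN]
          exact Nat.mul_stirlingFirst_lt (by omega) (by omega) hcN
end

section
/- Let k ≥ t+1 and let A ⊆ S_{n,k} be a maximal t-intersecting family (i.e., A is t-intersecting and is not properly contained in any t-intersecting subfamily of S_{n,k}). Let T = {c₁, …, c_t} be a set of t pairwise disjoint cycles, and suppose there exist k+1 permutations π₁, …, π_{k+1} ∈ A such that T ⊆ M(π_i) for each i and M(π_i) ∩ M(π_j) = T for all i ≠ j. Then A = {π ∈ S_{n,k} : T ⊆ M(π)}. -/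
/-- If `A ⊆ S_{n,k}` is maximal `t`-intersecting, `T` is a set of `t` pairwise
disjoint cycles, and there are `k + 1` permutations in `A` containing `T` among
their cycles and pairwise sharing exactly the cycles of `T`, then
`A = {π ∈ S_{n,k} : T ⊆ M(π)}`. -/
theorem stmt9 (n k t : ℕ) (hkt : t + 1 ≤ k) (A : Set (Equiv.Perm (Fin n)))
    (hA : ∀ π ∈ A, π.numCycles = k)
    (hInt : ∀ π₁ ∈ A, ∀ π₂ ∈ A, t ≤ (π₁.cycleSet ∩ π₂.cycleSet).ncard)
    (hMax : ∀ A' : Set (Equiv.Perm (Fin n)),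
      (∀ π ∈ A', π.numCycles = k) →
      (∀ π₁ ∈ A', ∀ π₂ ∈ A', t ≤ (π₁.cycleSet ∩ π₂.cycleSet).ncard) →
      A ⊆ A' → A' = A)
    (T : Set (Finset (Fin n) × (Fin n → Fin n))) (hT : T.ncard = t)
    (hTcyc : ∀ c ∈ T, ∃ σ : Equiv.Perm (Fin n), c ∈ σ.cycleSet)
    (hTdisj : ∀ c₁ ∈ T, ∀ c₂ ∈ T, c₁ ≠ c₂ → Disjoint c₁.1 c₂.1)
    (π : Fin (k + 1) → Equiv.Perm (Fin n))
    (hπA : ∀ i, π i ∈ A)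
    (hπT : ∀ i, T ⊆ (π i).cycleSet)
    (hπint : ∀ i j, i ≠ j → (π i).cycleSet ∩ (π j).cycleSet = T) :
    A = {σ : Equiv.Perm (Fin n) | σ.numCycles = k ∧ T ⊆ σ.cycleSet} := by
  have hsub : A ⊆ {σ : Equiv.Perm (Fin n) | σ.numCycles = k ∧ T ⊆ σ.cycleSet} := by
    intro σ hσ
    refine ⟨hA σ hσ, ?_⟩
    by_contra hTσ
    have hlt : (σ.cycleSet ∩ T).ncard < t := by
      rw [← hT]
      refine Set.ncard_lt_ncard ⟨Set.inter_subset_right, fun h => hTσ ?_⟩ (Set.toFinite T)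
      exact h.trans Set.inter_subset_left
    have hex : ∀ i, ∃ c, c ∈ σ.cycleSet ∧ c ∈ (π i).cycleSet ∧ c ∉ T := by
      intro i
      by_contra! h
      have hle : (σ.cycleSet ∩ (π i).cycleSet).ncard ≤ (σ.cycleSet ∩ T).ncard :=
        Set.ncard_le_ncard (fun c hc => ⟨hc.1, h c hc.1 hc.2⟩) (Set.toFinite _)
      exact absurd (hInt σ hσ (π i) (hπA i)) (by omega)
    choose f hfσ hfπ hfT using hex
    have hinj : Function.Injective f := by
      intro i j hij
      by_contra hne
      refine hfT i ?_
      rw [← hπint i j hne]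
      exact ⟨hfπ i, hij ▸ hfπ j⟩
    have hcard : (Set.range f).ncard ≤ σ.numCycles :=
      Set.ncard_le_ncard (Set.range_subset_iff.2 hfσ) (Set.toFinite _)
    rw [Set.ncard_range_of_injective hinj, Nat.card_fin, hA σ hσ] at hcard
    omega
  refine (hMax _ (fun σ hσ => hσ.1) (fun σ₁ h₁ σ₂ h₂ => ?_) hsub).symm
  rw [← hT]
  exact Set.ncard_le_ncard (Set.subset_inter h₁.2 h₂.2) (Set.toFinite _)
end
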